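/- arXiv:1101.0246 — 8 statements merged into one kernel-verified Lean document; each statement's English description precedes it below -/
import Mathlib

section
/- Let m ≥ 1 and let M be the m × m real matrix with entries M_{jk} = l² · (m_{max(j,k)} + m_{max(j,k)+1} + … + m_m), i.e. M_{jk} = l² Σ_{i = max(j,k)}^{m} m_i, where l, m_1, …, m_m are real numbers. Then det M = l^{2m} · ∏_{i=1}^{m} m_i. -/
/-- The matrix whose `(j, k)` entry is the sum of `d i` over `i ≥ max j k` is congruent to
`diagonal d` through the unitriangular matrix of the order relation, so its determinant is
`∏ i, d i`. -/
theorem Matrix.det_of_sum_ge_max {ι R : Type*} [Fintype ι] [LinearOrder ι] [CommRing R]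
    (d : ι → R) :
    (Matrix.of fun j k => ∑ i with max j k ≤ i, d i).det = ∏ i, d i := by
  let U : Matrix ι ι R := Matrix.of fun j i => if j ≤ i then 1 else 0
  have det_U : U.det = 1 := by
    have hU : U.IsUpperTriangular := fun i j hij => if_neg (not_le.mpr hij)
    simp [Matrix.det_of_isUpperTriangular hU, U]
  have factorization :
      (Matrix.of fun j k => ∑ i with max j k ≤ i, d i) = U * Matrix.diagonal d * U.transpose := by
    ext j k
    rw [Matrix.mul_apply]
    simp only [Matrix.mul_diagonal, Matrix.transpose_apply, Matrix.of_apply, U,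
      Finset.sum_filter, max_le_iff]
    refine Finset.sum_congr rfl fun i _ => ?_
    by_cases hj : j ≤ i <;> by_cases hk : k ≤ i <;> simp [hj, hk]
  rw [factorization]
  simp [det_U]

/-- The determinant of the mass matrix of the `m`-link Ziegler–Lobas pendulum
(with `m = n + 1 ≥ 1` links, rods of length `l` and point masses `μ 0, …, μ n`),
whose `(j,k)` entry is `l² · Σ_{i = max(j,k)}^{m} μ i`, equals
`l^(2m) · ∏ i, μ i`. -/
theorem ziegler_lobas_mass_matrix_det (n : ℕ) (l : ℝ) (μ : Fin (n + 1) → ℝ)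
    (M : Matrix (Fin (n + 1)) (Fin (n + 1)) ℝ)
    (hM : ∀ j k, M j k = l ^ 2 * ∑ i ∈ Finset.Icc (max j k) (Fin.last n), μ i) :
    M.det = l ^ (2 * (n + 1)) * ∏ i, μ i := by
  have hM' : M = Matrix.of fun j k => ∑ i with max j k ≤ i, l ^ 2 * μ i := by
    ext j k
    rw [hM, Finset.mul_sum, Matrix.of_apply]
    congr 1
    ext i
    simp [Fin.le_last]
  rw [hM', Matrix.det_of_sum_ge_max, Finset.prod_mul_distrib]
  simp [pow_mul]
end

section
/- Let l, m1, m2, c1, c2 > 0 and let P be real. The quadratic q(μ) = m1·m2·l⁴·μ² + (m1·c2 + 4·m2·c2 + c1·m2 − 2·P·l·m2)·l²·μ + c1·c2 has a repeated root if and only if (2·l·m2·P − m1·c2 − 4·m2·c2 − c1·m2)² = 4·m1·m2·c1·c2, which holds if and only if P = (4·m2·c2 + (√(m1·c2) + √(m2·c1))²)/(2·l·m2) or P = (4·m2·c2 + (√(m1·c2) − √(m2·c1))²)/(2·l·m2). -/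
/-- A quadratic is a multiple of the square of a linear factor iff its discriminant vanishes. -/
theorem exists_forall_quadratic_eq_mul_sq_iff {K : Type*} [Field K] [NeZero (2 : K)] {a b c : K}
    (ha : a ≠ 0) :
    (∃ z, ∀ x, a * x ^ 2 + b * x + c = a * (x - z) ^ 2) ↔ discrim a b c = 0 := by
  have h2 : (2 : K) ≠ 0 := NeZero.ne 2
  unfold discrim
  constructor
  · rintro ⟨z, hz⟩
    have hc : c = a * z ^ 2 := by linear_combination hz 0
    have hb : b = -2 * a * z := by
      apply mul_left_cancel₀ h2
      linear_combination hz 1 - hz (-1)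
    rw [hb, hc]
    ring
  · intro h
    refine ⟨-b / (2 * a), fun x => ?_⟩
    field_simp
    linear_combination -h


/-- Flutter boundary of the undamped two-link Ziegler pendulum: the quadratic
`q(μ) = m1 m2 l⁴ μ² + (m1 c2 + 4 m2 c2 + c1 m2 − 2 P l m2) l² μ + c1 c2`
has a repeated (complex) root iff
`(2 l m2 P − m1 c2 − 4 m2 c2 − c1 m2)² = 4 m1 m2 c1 c2`, which holds iff
`P = (4 m2 c2 + (√(m1 c2) ± √(m2 c1))²)/(2 l m2)`. -/
theorem ziegler_two_link_flutter_boundary (l m1 m2 c1 c2 P : ℝ)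
    (hl : 0 < l) (hm1 : 0 < m1) (hm2 : 0 < m2) (hc1 : 0 < c1) (hc2 : 0 < c2) :
    ((∃ z : ℂ, ∀ μ : ℂ,
        ((m1 * m2 * l ^ 4 : ℝ) : ℂ) * μ ^ 2 +
            (((m1 * c2 + 4 * m2 * c2 + c1 * m2 - 2 * P * l * m2) * l ^ 2 : ℝ) : ℂ) * μ +
            ((c1 * c2 : ℝ) : ℂ) =
          ((m1 * m2 * l ^ 4 : ℝ) : ℂ) * (μ - z) ^ 2) ↔
      (2 * l * m2 * P - m1 * c2 - 4 * m2 * c2 - c1 * m2) ^ 2 = 4 * m1 * m2 * c1 * c2) ∧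
    ((2 * l * m2 * P - m1 * c2 - 4 * m2 * c2 - c1 * m2) ^ 2 = 4 * m1 * m2 * c1 * c2 ↔
      P = (4 * m2 * c2 + (Real.sqrt (m1 * c2) + Real.sqrt (m2 * c1)) ^ 2) / (2 * l * m2) ∨
      P = (4 * m2 * c2 + (Real.sqrt (m1 * c2) - Real.sqrt (m2 * c1)) ^ 2) / (2 * l * m2)) := by
  have hdisc : (2 * l * m2 * P - m1 * c2 - 4 * m2 * c2 - c1 * m2) ^ 2 = 4 * m1 * m2 * c1 * c2 ↔
      discrim (m1 * m2 * l ^ 4)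
        ((m1 * c2 + 4 * m2 * c2 + c1 * m2 - 2 * P * l * m2) * l ^ 2) (c1 * c2) = 0 := by
    have hl4 : l ^ 4 ≠ 0 := by positivity
    rw [← sub_eq_zero, ← mul_right_inj' hl4, mul_zero, discrim]
    ring_nf
  constructor
  · rw [exists_forall_quadratic_eq_mul_sq_iff (by exact_mod_cast (by positivity)), hdisc]
    simp only [discrim]
    norm_cast
  · have hs : √(m1 * c2) ^ 2 = m1 * c2 := Real.sq_sqrt (by positivity)
    have ht : √(m2 * c1) ^ 2 = m2 * c1 := Real.sq_sqrt (by positivity)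
    have hst : 4 * m1 * m2 * c1 * c2 = (2 * √(m1 * c2) * √(m2 * c1)) ^ 2 := by
      rw [mul_pow, mul_pow, hs, ht]
      ring
    have hd : 2 * l * m2 ≠ 0 := by positivity
    rw [hst, sq_eq_sq_iff_eq_or_eq_neg, eq_div_iff hd, eq_div_iff hd]
    refine or_congr ?_ ?_ <;> constructor <;> intro h <;> linarith
end

section
/- Let l, m1, m2, c1, c2 > 0, let p_− = 2 + (1/2)·(√(m1/m2) − √(c1/c2))², and let P be a real number with P·l/c2 < p_−. Then the quartic Q(λ) = m1·m2·l⁴·λ⁴ + (m1·c2 + 4·m2·c2 + c1·m2 − 2·P·l·m2)·l²·λ² + c1·c2 has four pairwise distinct complex roots, all of which are purely imaginary (zero real part and nonzero imaginary part); i.e., the pendulum is marginally stable below the lower critical flutter load. -/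
/-- A real biquadratic with positive coefficients and positive discriminant has four distinct
roots `± u i`, `± v i`; this produces the frequencies `u < v`. -/
theorem exists_frequencies_of_discrim_pos {a b c : ℝ} (ha : 0 < a) (hb : 0 < b) (hc : 0 < c)
    (hD : 4 * a * c < b ^ 2) :
    ∃ u v : ℝ, 0 < u ∧ u < v ∧ b = a * (u ^ 2 + v ^ 2) ∧ c = a * (u ^ 2 * v ^ 2) := by
  set d := Real.sqrt (b ^ 2 - 4 * a * c)
  have hd_pos : 0 < d := Real.sqrt_pos.2 (by linarith)
  have hd_sq : d ^ 2 = b ^ 2 - 4 * a * c := Real.sq_sqrt (by linarith)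
  have hdb : d < b := by
    have hac : 0 < a * c := mul_pos ha hc
    exact lt_of_pow_lt_pow_left₀ 2 hb.le (by linarith)
  have hu : 0 < (b - d) / (2 * a) := div_pos (by linarith) (by linarith)
  have huv : (b - d) / (2 * a) < (b + d) / (2 * a) :=
    div_lt_div_of_pos_right (by linarith) (by linarith)
  refine ⟨Real.sqrt ((b - d) / (2 * a)), Real.sqrt ((b + d) / (2 * a)), Real.sqrt_pos.2 hu,
    Real.sqrt_lt_sqrt hu.le huv, ?_, ?_⟩
  · rw [Real.sq_sqrt hu.le, Real.sq_sqrt (hu.trans huv).le]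
    field_simp
    ring
  · rw [Real.sq_sqrt hu.le, Real.sq_sqrt (hu.trans huv).le]
    field_simp
    linear_combination hd_sq

/-- Below the lower critical flutter load, the coefficient of `l² λ²` exceeds
`2 √(m1 m2 c1 c2)`, here written with `√(m1/m2)` and `√(c1/c2)`. -/
theorem lt_coeff_of_lt_critical_load {l m1 m2 c1 c2 P : ℝ}
    (hm1 : 0 < m1) (hm2 : 0 < m2) (hc1 : 0 < c1) (hc2 : 0 < c2)
    (hP : P * l / c2 < 2 + (1 / 2) * (Real.sqrt (m1 / m2) - Real.sqrt (c1 / c2)) ^ 2) :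
    2 * (Real.sqrt (m1 / m2) * Real.sqrt (c1 / c2)) * (m2 * c2) <
      m1 * c2 + 4 * m2 * c2 + c1 * m2 - 2 * P * l * m2 := by
  have hs := Real.sq_sqrt (div_pos hm1 hm2).le
  have ht := Real.sq_sqrt (div_pos hc1 hc2).le
  have key : 2 * (Real.sqrt (m1 / m2) * Real.sqrt (c1 / c2)) <
      m1 / m2 + 4 + c1 / c2 - 2 * (P * l / c2) := by
    rw [← hs, ← ht]
    simp only [Real.sqrt_sq (Real.sqrt_nonneg _)]
    linarith
  calc _ < (m1 / m2 + 4 + c1 / c2 - 2 * (P * l / c2)) * (m2 * c2) :=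
        mul_lt_mul_of_pos_right key (mul_pos hm2 hc2)
    _ = _ := by field_simp

/-- Marginal stability below the lower critical flutter load: if
`P l / c2 < p₋ = 2 + (1/2)(√(m1/m2) − √(c1/c2))²`, the quartic
`Q(λ) = m1 m2 l⁴ λ⁴ + (m1 c2 + 4 m2 c2 + c1 m2 − 2 P l m2) l² λ² + c1 c2`
has four pairwise distinct, purely imaginary complex roots. -/
theorem ziegler_two_link_marginal_stability (l m1 m2 c1 c2 P : ℝ)
    (hl : 0 < l) (hm1 : 0 < m1) (hm2 : 0 < m2) (hc1 : 0 < c1) (hc2 : 0 < c2)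
    (hP : P * l / c2 < 2 + (1 / 2) * (Real.sqrt (m1 / m2) - Real.sqrt (c1 / c2)) ^ 2) :
    ∃ z1 z2 z3 z4 : ℂ,
      z1 ≠ z2 ∧ z1 ≠ z3 ∧ z1 ≠ z4 ∧ z2 ≠ z3 ∧ z2 ≠ z4 ∧ z3 ≠ z4 ∧
      (z1.re = 0 ∧ z1.im ≠ 0) ∧ (z2.re = 0 ∧ z2.im ≠ 0) ∧
      (z3.re = 0 ∧ z3.im ≠ 0) ∧ (z4.re = 0 ∧ z4.im ≠ 0) ∧
      ∀ lam : ℂ,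
        ((m1 * m2 * l ^ 4 : ℝ) : ℂ) * lam ^ 4 +
            (((m1 * c2 + 4 * m2 * c2 + c1 * m2 - 2 * P * l * m2) * l ^ 2 : ℝ) : ℂ) * lam ^ 2 +
            ((c1 * c2 : ℝ) : ℂ) =
          ((m1 * m2 * l ^ 4 : ℝ) : ℂ) * (lam - z1) * (lam - z2) * (lam - z3) * (lam - z4) := by
  have hlt := lt_coeff_of_lt_critical_load hm1 hm2 hc1 hc2 hP
  have hst : 0 < 2 * (Real.sqrt (m1 / m2) * Real.sqrt (c1 / c2)) * (m2 * c2) := by positivity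
  have hst_sq : (2 * (Real.sqrt (m1 / m2) * Real.sqrt (c1 / c2)) * (m2 * c2)) ^ 2 =
      4 * (m1 * m2) * (c1 * c2) := by
    rw [mul_pow, mul_pow, mul_pow, Real.sq_sqrt (div_pos hm1 hm2).le,
      Real.sq_sqrt (div_pos hc1 hc2).le]
    field_simp
    norm_num
  have hsq := pow_lt_pow_left₀ hlt hst.le two_ne_zero
  rw [hst_sq] at hsq
  obtain ⟨u, v, hu, huv, hB, hC⟩ := exists_frequencies_of_discrim_pos
    (a := m1 * m2 * l ^ 4)
    (b := (m1 * c2 + 4 * m2 * c2 + c1 * m2 - 2 * P * l * m2) * l ^ 2) (c := c1 * c2)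
    (by positivity) (mul_pos (hst.trans hlt) (by positivity)) (by positivity)
    (by
      have := mul_lt_mul_of_pos_right hsq (pow_pos hl 4)
      linarith)
  rw [hB, hC]
  have hv := hu.trans huv
  have hne {x y : ℝ} (h : x ≠ y) : (⟨0, x⟩ : ℂ) ≠ ⟨0, y⟩ := fun e => h (congrArg Complex.im e)
  refine ⟨⟨0, u⟩, ⟨0, -u⟩, ⟨0, v⟩, ⟨0, -v⟩, hne (by intro h; linarith), hne (by intro h; linarith),
    hne (by intro h; linarith), hne (by intro h; linarith), hne (by intro h; linarith),
    hne (by intro h; linarith),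
    ⟨rfl, hu.ne'⟩, ⟨rfl, (neg_lt_zero.2 hu).ne⟩, ⟨rfl, hv.ne'⟩, ⟨rfl, (neg_lt_zero.2 hv).ne⟩, ?_⟩
  intro lam
  have hmk (x : ℝ) : (⟨0, x⟩ : ℂ) = x * Complex.I := by
    apply Complex.ext <;> simp
  simp only [hmk]
  push_cast
  linear_combination (m1 * m2 * l ^ 4 : ℂ) * (lam ^ 2 * (u ^ 2 + v ^ 2) +
    u ^ 2 * v ^ 2 * (1 - Complex.I ^ 2)) * Complex.I_sq
end

section
/- Let l, m1, m2, c1, c2 > 0, let p± = 2 + (1/2)·(√(m1/m2) ± √(c1/c2))², and let P be a real number with p_− < P·l/c2 < p_+. Then the quadratic in μ = λ², m1·m2·l⁴·μ² + (m1·c2 + 4·m2·c2 + c1·m2 − 2·P·l·m2)·l²·μ + c1·c2, has a pair of non-real complex-conjugate roots, and consequently the quartic Q(λ) = m1·m2·l⁴·λ⁴ + (m1·c2 + 4·m2·c2 + c1·m2 − 2·P·l·m2)·l²·λ² + c1·c2 has a complex root λ with strictly positive real part (flutter instability for loads strictly between the two critical values). -/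
/-- A real quadratic with negative discriminant splits over `ℂ` into a pair of non-real
conjugate linear factors. -/
theorem exists_conj_factorization_of_discrim_neg {A B C : ℝ} (hA : A ≠ 0)
    (h : discrim A B C < 0) :
    ∃ z : ℂ, z.im ≠ 0 ∧ ∀ μ : ℂ, (A : ℂ) * μ ^ 2 + (B : ℂ) * μ + (C : ℂ) =
      (A : ℂ) * (μ - z) * (μ - (starRingEnd ℂ) z) := by
  have hD : 0 < -discrim A B C := neg_pos.mpr h
  set s := Real.sqrt (-discrim A B C) with hs
  have hs0 : 0 < s := Real.sqrt_pos.mpr hD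
  have hs2 : s ^ 2 = 4 * A * C - B ^ 2 := by
    rw [hs, Real.sq_sqrt hD.le, discrim]; ring
  refine ⟨⟨-B / (2 * A), s / (2 * A)⟩, ?_, fun μ => ?_⟩
  · have : s / (2 * A) ≠ 0 := by positivity
    exact this
  · have hsum : A * (2 * (-B / (2 * A))) = -B := by field_simp
    have hprod : A * ((-B / (2 * A)) ^ 2 + (s / (2 * A)) ^ 2) = C := by
      rw [div_pow, div_pow, hs2]
      field_simp
      ring
    generalize -B / (2 * A) = x at *
    generalize s / (2 * A) = y at *
    have hB : B = -(A * (2 * x)) := by linarith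
    rw [hB, ← hprod]
    apply Complex.ext <;> simp [pow_two] <;> ring

/-- Every non-real complex number has a square root with strictly positive real part. -/
theorem Complex.exists_sq_eq_re_pos {z : ℂ} (hz : z.im ≠ 0) :
    ∃ w : ℂ, 0 < w.re ∧ w ^ 2 = z := by
  obtain ⟨w, rfl⟩ := IsAlgClosed.exists_pow_nat_eq z two_pos
  have hw : w.re ≠ 0 := fun h => hz (by simp [pow_two, h])
  rcases hw.lt_or_gt with h | h
  · exact ⟨-w, by simpa using h, neg_sq w⟩
  · exact ⟨w, h, rfl⟩

/-- Between the two critical loads, the discriminant of the Ziegler quadratic is negative. -/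
theorem ziegler_discrim_neg (l m1 m2 c1 c2 P : ℝ)
    (hl : 0 < l) (hm1 : 0 < m1) (hm2 : 0 < m2) (hc1 : 0 < c1) (hc2 : 0 < c2)
    (hPlow : 2 + (1 / 2) * (Real.sqrt (m1 / m2) - Real.sqrt (c1 / c2)) ^ 2 < P * l / c2)
    (hPhigh : P * l / c2 < 2 + (1 / 2) * (Real.sqrt (m1 / m2) + Real.sqrt (c1 / c2)) ^ 2) :
    discrim (m1 * m2 * l ^ 4) ((m1 * c2 + 4 * m2 * c2 + c1 * m2 - 2 * P * l * m2) * l ^ 2)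
      (c1 * c2) < 0 := by
  have ha : Real.sqrt (m1 / m2) ^ 2 = m1 / m2 := Real.sq_sqrt (by positivity)
  have hb : Real.sqrt (c1 / c2) ^ 2 = c1 / c2 := Real.sq_sqrt (by positivity)
  generalize Real.sqrt (m1 / m2) = a at *
  generalize Real.sqrt (c1 / c2) = b at *
  obtain rfl : m1 = a ^ 2 * m2 := by rw [ha]; field_simp
  obtain rfl : c1 = b ^ 2 * c2 := by rw [hb]; field_simp
  obtain ⟨p, rfl⟩ : ∃ p, P = p * c2 / l := ⟨P * l / c2, by field_simp⟩
  have hp : p * c2 / l * l / c2 = p := by field_simp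
  rw [hp] at hPlow hPhigh
  have key : (a ^ 2 + 4 + b ^ 2 - 2 * p) ^ 2 - (2 * a * b) ^ 2 < 0 := by
    rw [sq_sub_sq]
    exact mul_neg_of_pos_of_neg (by linarith) (by linarith)
  have hdisc : discrim (a ^ 2 * m2 * m2 * l ^ 4)
      ((a ^ 2 * m2 * c2 + 4 * m2 * c2 + b ^ 2 * c2 * m2 - 2 * (p * c2 / l) * l * m2) * l ^ 2)
      (b ^ 2 * c2 * c2) =
      (m2 * c2 * l ^ 2) ^ 2 * ((a ^ 2 + 4 + b ^ 2 - 2 * p) ^ 2 - (2 * a * b) ^ 2) := by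
    rw [discrim]
    field_simp
    ring
  rw [hdisc]
  exact mul_neg_of_pos_of_neg (by positivity) key

/-- Flutter instability strictly between the two critical loads: if
`p₋ < P l / c2 < p₊` with `p± = 2 + (1/2)(√(m1/m2) ± √(c1/c2))²`, then the quadratic
in `μ = λ²` has a pair of non-real complex-conjugate roots, and the quartic `Q(λ)`
has a root with strictly positive real part. -/
theorem ziegler_two_link_flutter_instability (l m1 m2 c1 c2 P : ℝ)
    (hl : 0 < l) (hm1 : 0 < m1) (hm2 : 0 < m2) (hc1 : 0 < c1) (hc2 : 0 < c2)
    (hPlow : 2 + (1 / 2) * (Real.sqrt (m1 / m2) - Real.sqrt (c1 / c2)) ^ 2 < P * l / c2)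
    (hPhigh : P * l / c2 < 2 + (1 / 2) * (Real.sqrt (m1 / m2) + Real.sqrt (c1 / c2)) ^ 2) :
    (∃ z : ℂ, z.im ≠ 0 ∧ ∀ μ : ℂ,
        ((m1 * m2 * l ^ 4 : ℝ) : ℂ) * μ ^ 2 +
            (((m1 * c2 + 4 * m2 * c2 + c1 * m2 - 2 * P * l * m2) * l ^ 2 : ℝ) : ℂ) * μ +
            ((c1 * c2 : ℝ) : ℂ) =
          ((m1 * m2 * l ^ 4 : ℝ) : ℂ) * (μ - z) * (μ - (starRingEnd ℂ) z)) ∧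
    (∃ lam : ℂ, 0 < lam.re ∧
        ((m1 * m2 * l ^ 4 : ℝ) : ℂ) * lam ^ 4 +
            (((m1 * c2 + 4 * m2 * c2 + c1 * m2 - 2 * P * l * m2) * l ^ 2 : ℝ) : ℂ) * lam ^ 2 +
            ((c1 * c2 : ℝ) : ℂ) = 0) := by
  obtain ⟨z, hz, hfac⟩ := exists_conj_factorization_of_discrim_neg
    (by positivity : m1 * m2 * l ^ 4 ≠ 0)
    (ziegler_discrim_neg l m1 m2 c1 c2 P hl hm1 hm2 hc1 hc2 hPlow hPhigh)
  obtain ⟨w, hw, rfl⟩ := Complex.exists_sq_eq_re_pos hz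
  refine ⟨⟨w ^ 2, hz, hfac⟩, w, hw, ?_⟩
  have h := hfac (w ^ 2)
  rw [sub_self, mul_zero, zero_mul, ← pow_mul] at h
  exact h
end

section
/- Let l, m1, m2, c1, c2 > 0, let p_+ = 2 + (1/2)·(√(m1/m2) + √(c1/c2))², and let P be a real number with P·l/c2 > p_+. Then both roots of the quadratic in μ = λ², m1·m2·l⁴·μ² + (m1·c2 + 4·m2·c2 + c1·m2 − 2·P·l·m2)·l²·μ + c1·c2, are real, positive and distinct, and consequently the quartic Q(λ) = m1·m2·l⁴·λ⁴ + (m1·c2 + 4·m2·c2 + c1·m2 − 2·P·l·m2)·l²·λ² + c1·c2 has a real root λ > 0 (divergence instability above the upper critical load). -/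
/-- A real quadratic with positive leading and constant coefficients, negative linear coefficient
and positive discriminant splits with two distinct positive roots. -/
theorem exists_pos_roots_of_discrim_pos {A B C : ℝ} (hA : 0 < A) (hB : B < 0) (hC : 0 < C)
    (hD : 4 * A * C < B ^ 2) :
    ∃ x y : ℝ, 0 < x ∧ 0 < y ∧ x ≠ y ∧
      ∀ t : ℝ, A * t ^ 2 + B * t + C = A * (t - x) * (t - y) := by
  have hs : 0 < √(B ^ 2 - 4 * A * C) := Real.sqrt_pos.mpr (by linarith)
  have hsq : √(B ^ 2 - 4 * A * C) ^ 2 = B ^ 2 - 4 * A * C := Real.sq_sqrt (by linarith)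
  set s := √(B ^ 2 - 4 * A * C)
  have hsB : s < -B := by nlinarith [mul_pos hA hC]
  refine ⟨(-B + s) / (2 * A), (-B - s) / (2 * A), div_pos (by linarith) (by linarith),
    div_pos (by linarith) (by linarith), ?_, fun t => ?_⟩
  · intro h
    rw [div_left_inj' (by positivity)] at h
    linarith
  · field_simp
    linear_combination hsq

/-- Above the upper critical load the linear coefficient is less than `-2 √(m1 m2 c1 c2)`. -/
theorem ziegler_linear_coeff_lt {l m1 m2 c1 c2 P : ℝ}
    (hm1 : 0 < m1) (hm2 : 0 < m2) (hc1 : 0 < c1) (hc2 : 0 < c2)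
    (hP : 2 + (1 / 2) * (√(m1 / m2) + √(c1 / c2)) ^ 2 < P * l / c2) :
    m1 * c2 + 4 * m2 * c2 + c1 * m2 - 2 * P * l * m2 < -(2 * √(m1 * m2 * c1 * c2)) := by
  have ha := Real.sq_sqrt (div_pos hm1 hm2).le
  have hb := Real.sq_sqrt (div_pos hc1 hc2).le
  have hab : √(m1 * m2 * c1 * c2) = √(m1 / m2) * √(c1 / c2) * (m2 * c2) := by
    rw [Real.sqrt_eq_iff_mul_self_eq (by positivity) (by positivity)]
    symm
    calc √(m1 / m2) * √(c1 / c2) * (m2 * c2) * (√(m1 / m2) * √(c1 / c2) * (m2 * c2))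
        = √(m1 / m2) ^ 2 * √(c1 / c2) ^ 2 * (m2 * c2) ^ 2 := by ring
      _ = m1 * m2 * c1 * c2 := by rw [ha, hb]; field_simp
  have hm : √(m1 / m2) ^ 2 * m2 = m1 := by rw [ha]; field_simp
  have hc : √(c1 / c2) ^ 2 * c2 = c1 := by rw [hb]; field_simp
  rw [lt_div_iff₀ hc2] at hP
  rw [hab]
  linear_combination 2 * m2 * hP - c2 * hm - m2 * hc

/-- Divergence instability above the upper critical load: if
`P l / c2 > p₊ = 2 + (1/2)(√(m1/m2) + √(c1/c2))²`, then both roots of the quadratic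
in `μ = λ²` are real, positive and distinct, and the quartic `Q(λ)` has a real root
`λ > 0`. -/
theorem ziegler_two_link_divergence (l m1 m2 c1 c2 P : ℝ)
    (hl : 0 < l) (hm1 : 0 < m1) (hm2 : 0 < m2) (hc1 : 0 < c1) (hc2 : 0 < c2)
    (hP : 2 + (1 / 2) * (Real.sqrt (m1 / m2) + Real.sqrt (c1 / c2)) ^ 2 < P * l / c2) :
    (∃ μ1 μ2 : ℝ, 0 < μ1 ∧ 0 < μ2 ∧ μ1 ≠ μ2 ∧ ∀ μ : ℝ,
        m1 * m2 * l ^ 4 * μ ^ 2 +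
            (m1 * c2 + 4 * m2 * c2 + c1 * m2 - 2 * P * l * m2) * l ^ 2 * μ + c1 * c2 =
          m1 * m2 * l ^ 4 * (μ - μ1) * (μ - μ2)) ∧
    (∃ lam : ℝ, 0 < lam ∧
        m1 * m2 * l ^ 4 * lam ^ 4 +
            (m1 * c2 + 4 * m2 * c2 + c1 * m2 - 2 * P * l * m2) * l ^ 2 * lam ^ 2 +
          c1 * c2 = 0) := by
  set b := m1 * c2 + 4 * m2 * c2 + c1 * m2 - 2 * P * l * m2
  have hb : b < -(2 * √(m1 * m2 * c1 * c2)) := ziegler_linear_coeff_lt hm1 hm2 hc1 hc2 hP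
  have hs : 0 < √(m1 * m2 * c1 * c2) := by positivity
  have hsq : √(m1 * m2 * c1 * c2) ^ 2 = m1 * m2 * c1 * c2 := Real.sq_sqrt (by positivity)
  have hD : 4 * (m1 * m2 * l ^ 4) * (c1 * c2) < (b * l ^ 2) ^ 2 := by
    have hbD : 4 * (m1 * m2 * c1 * c2) < b ^ 2 := by nlinarith
    linear_combination l ^ 4 * hbD
  obtain ⟨x, y, hx, hy, hxy, h⟩ := exists_pos_roots_of_discrim_pos
    (A := m1 * m2 * l ^ 4) (B := b * l ^ 2) (C := c1 * c2) (by positivity)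
    (mul_neg_of_neg_of_pos (by linarith) (by positivity)) (by positivity) hD
  refine ⟨⟨x, y, hx, hy, hxy, h⟩, √x, Real.sqrt_pos.mpr hx, ?_⟩
  have hx2 : √x ^ 2 = x := Real.sq_sqrt hx.le
  have hx4 : √x ^ 4 = x ^ 2 := by rw [show 4 = 2 * 2 from rfl, pow_mul, hx2]
  rw [hx4, hx2, h x]
  ring
end

section
/- Let l, m1, m2, c1, c2, d1, d2 > 0 and let P be real. Every complex root of the quartic a0·λ⁴ + a1·λ³ + a2·λ² + a3·λ + a4 — with a0 = l⁴·m1·m2, a1 = l²·(m1·d2 + d1·m2 + 4·m2·d2), a2 = d1·d2 + m1·l²·c2 + 4·m2·l²·c2 + c1·m2·l² − 2·P·l³·m2, a3 = d1·c2 + c1·d2, a4 = c1·c2 — has strictly negative real part if and only if P < P_cr, where P_cr = [4·m2²·(d2²·c1² + d1²·c2²) + d1·d2·(8·m2·(m1 + 2·m2)·c2² + (c1·m2 − m1·c2)²)] / [2·m2·l·(4·m2·d2 + d1·m2 + m1·d2)·(c1·d2 + d1·c2)] + (1/2)·(d1·d2)/(m2·l³). -/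
open Polynomial in
/-- A complex quadratic with nonzero leading coefficient has a root. -/
lemma exists_root_quadratic (a b c : ℂ) (ha : a ≠ 0) : ∃ z : ℂ, a * z ^ 2 + b * z + c = 0 := by
  obtain ⟨z, hz⟩ := IsAlgClosed.exists_root (C a * X ^ 2 + C b * X + C c)
    (by rw [degree_quadratic ha]; norm_num)
  exact ⟨z, by simpa [IsRoot] using hz⟩

open Polynomial in
/-- A complex cubic with nonzero leading coefficient has a root. -/
lemma exists_root_cubic (a b c d : ℂ) (ha : a ≠ 0) :
    ∃ z : ℂ, a * z ^ 3 + b * z ^ 2 + c * z + d = 0 := by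
  obtain ⟨z, hz⟩ := IsAlgClosed.exists_root (C a * X ^ 3 + C b * X ^ 2 + C c * X + C d)
    (by rw [degree_cubic ha]; norm_num)
  exact ⟨z, by simpa [IsRoot] using hz⟩

open Polynomial in
/-- A complex quartic with nonzero leading coefficient has a root. -/
lemma exists_root_quartic (a b c d e : ℂ) (ha : a ≠ 0) :
    ∃ z : ℂ, a * z ^ 4 + b * z ^ 3 + c * z ^ 2 + d * z + e = 0 := by
  have hdeg : (C a * X ^ 4 + (C b * X ^ 3 + C c * X ^ 2 + C d * X + C e)).degree = 4 := by
    rw [degree_add_eq_left_of_degree_lt] <;> rw [degree_C_mul_X_pow 4 ha]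
    · rfl
    · exact lt_of_le_of_lt degree_cubic_le (by norm_num)
  obtain ⟨z, hz⟩ := IsAlgClosed.exists_root _ (by rw [hdeg]; norm_num)
  refine ⟨z, ?_⟩
  have : a * z ^ 4 + (b * z ^ 3 + c * z ^ 2 + d * z + e) = 0 := by simpa [IsRoot] using hz
  linear_combination this

/-- A nonreal root `z` of a real quartic splits off the real quadratic factor
`X ^ 2 - 2 * z.re * X + (z.re ^ 2 + z.im ^ 2)`. -/
lemma quartic_coeffs_of_nonreal_root {a0 a1 a2 a3 a4 : ℝ} {z : ℂ} (him : z.im ≠ 0)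
    (hz : (a0 : ℂ) * z ^ 4 + a1 * z ^ 3 + a2 * z ^ 2 + a3 * z + a4 = 0) :
    ∃ b c : ℝ, a1 = b + a0 * (-2 * z.re) ∧
      a2 = c + b * (-2 * z.re) + a0 * (z.re ^ 2 + z.im ^ 2) ∧
      a3 = c * (-2 * z.re) + b * (z.re ^ 2 + z.im ^ 2) ∧ a4 = c * (z.re ^ 2 + z.im ^ 2) := by
  obtain ⟨x, y⟩ := z
  simp only at him ⊢
  set b := a1 + 2 * a0 * x with hb
  set c := a2 + 2 * b * x - a0 * (x ^ 2 + y ^ 2) with hc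
  have hre := congrArg Complex.re hz
  have hi := congrArg Complex.im hz
  simp [pow_succ] at hre hi
  have h3 : a3 = c * (-2 * x) + b * (x ^ 2 + y ^ 2) := by
    apply mul_right_cancel₀ him
    rw [hc, hb]
    linear_combination hi
  refine ⟨b, c, by rw [hb]; ring, by rw [hc]; ring, h3, ?_⟩
  rw [hc, hb] at h3 ⊢
  linear_combination hre - x * h3

/-- The Hurwitz determinant of a product of two real quadratics. -/
lemma hurwitz_det_mul_quadratic (a0 b c s r : ℝ) :
    (b + a0 * s) * (c + b * s + a0 * r) * (c * s + b * r) - a0 * (c * s + b * r) ^ 2 -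
        (b + a0 * s) ^ 2 * (c * r) =
      s * b * ((c - a0 * r) ^ 2 + (b + a0 * s) * (c * s + b * r)) := by
  ring

/-- The linear coefficient of a real quadratic with positive leading coefficient is positive if
its roots lie in the open left half plane. -/
lemma quadratic_linear_coeff_pos {a b c : ℝ} (ha : 0 < a)
    (h : ∀ z : ℂ, (a : ℂ) * z ^ 2 + b * z + c = 0 → z.re < 0) : 0 < b := by
  have ha' : (a : ℂ) ≠ 0 := by exact_mod_cast ha.ne'
  obtain ⟨z, hz⟩ := exists_root_quadratic a b c ha'
  have h1 := h z hz
  have h2 := h (((-b / a : ℝ) : ℂ) - z) (by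
    push_cast
    field_simp
    linear_combination a * hz)
  rw [Complex.sub_re, Complex.ofReal_re] at h2
  have h3 : -b / a < 0 := by linarith
  rw [div_lt_iff₀ ha] at h3
  linarith

/-- If a real quartic with positive coefficients `a0`, `a1`, `a3` is stable and has a real
quadratic factor `X ^ 2 + s * X + r` with `0 < s`, its Hurwitz determinant is positive. -/
lemma hurwitz_det_pos_of_factor {a0 a1 a2 a3 a4 b c s r : ℝ} (h0 : 0 < a0) (h1 : 0 < a1)
    (h3 : 0 < a3)
    (h : ∀ z : ℂ, (a0 : ℂ) * z ^ 4 + a1 * z ^ 3 + a2 * z ^ 2 + a3 * z + a4 = 0 → z.re < 0)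
    (hs : 0 < s) (e1 : a1 = b + a0 * s) (e2 : a2 = c + b * s + a0 * r)
    (e3 : a3 = c * s + b * r) (e4 : a4 = c * r) :
    0 < a1 * a2 * a3 - a0 * a3 ^ 2 - a1 ^ 2 * a4 := by
  have hb : 0 < b := quadratic_linear_coeff_pos (c := c) h0 fun z hz => h z (by
    rw [e1, e2, e3, e4]
    push_cast
    linear_combination (z ^ 2 + s * z + r) * hz)
  subst e1 e2 e3 e4
  rw [hurwitz_det_mul_quadratic]
  positivity

/-- Routh–Hurwitz criterion for real quartics whose coefficients, except possibly the quadratic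
one, are positive. -/
theorem routh_hurwitz_quartic {a0 a1 a2 a3 a4 : ℝ} (h0 : 0 < a0) (h1 : 0 < a1) (h3 : 0 < a3)
    (h4 : 0 < a4) :
    (∀ z : ℂ, (a0 : ℂ) * z ^ 4 + a1 * z ^ 3 + a2 * z ^ 2 + a3 * z + a4 = 0 → z.re < 0) ↔
      0 < a1 * a2 * a3 - a0 * a3 ^ 2 - a1 ^ 2 * a4 := by
  have h0' : (a0 : ℂ) ≠ 0 := by exact_mod_cast h0.ne'
  constructor
  · intro h
    by_cases hreal : ∃ z : ℂ, z.im ≠ 0 ∧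
        (a0 : ℂ) * z ^ 4 + a1 * z ^ 3 + a2 * z ^ 2 + a3 * z + a4 = 0
    · obtain ⟨z, him, hz⟩ := hreal
      obtain ⟨b, c, e1, e2, e3, e4⟩ := quartic_coeffs_of_nonreal_root him hz
      exact hurwitz_det_pos_of_factor h0 h1 h3 h (by linarith [h z hz]) e1 e2 e3 e4
    · push Not at hreal
      have real_of_root : ∀ z : ℂ,
          (a0 : ℂ) * z ^ 4 + a1 * z ^ 3 + a2 * z ^ 2 + a3 * z + a4 = 0 → ∃ t : ℝ, z = t :=
        fun z hz => ⟨z.re, Complex.ext rfl (by_contra fun him => hreal z him hz)⟩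
      obtain ⟨z, hz⟩ := exists_root_quartic a0 a1 a2 a3 a4 h0'
      obtain ⟨t, rfl⟩ := real_of_root z hz
      obtain ⟨w, hw⟩ := exists_root_cubic a0 (a1 + a0 * t) (a2 + (a1 + a0 * t) * t)
        (a3 + (a2 + (a1 + a0 * t) * t) * t) h0'
      have hw' : (a0 : ℂ) * w ^ 4 + a1 * w ^ 3 + a2 * w ^ 2 + a3 * w + a4 = 0 := by
        linear_combination (w - t) * hw + hz
      obtain ⟨u, rfl⟩ := real_of_root w hw'
      have ht : t < 0 := h t hz
      have hu : u < 0 := h u hw'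
      norm_cast at hz hw
      refine hurwitz_det_pos_of_factor (s := -(t + u)) (r := t * u) (b := a1 + a0 * (t + u))
        (c := a2 + (a1 + a0 * (t + u)) * (t + u) - a0 * (t * u)) h0 h1 h3 h
        (by linarith) (by ring) (by ring) ?_ ?_
      · linear_combination hw
      · linear_combination hz - t * hw
  · intro hdet z hz
    by_contra! hx
    have h2 : 0 < a2 := by
      have : 0 < a1 * a3 * a2 := by nlinarith [mul_pos h0 (pow_pos h3 2), mul_pos (pow_pos h1 2) h4]
      exact pos_of_mul_pos_right this (by positivity)
    by_cases him : z.im = 0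
    · obtain ⟨x, rfl⟩ : ∃ x : ℝ, z = x := ⟨z.re, Complex.ext rfl him⟩
      norm_cast at hz
      rw [Complex.ofReal_re] at hx
      have : 0 < a0 * x ^ 4 + a1 * x ^ 3 + a2 * x ^ 2 + a3 * x + a4 := by positivity
      exact this.ne' hz
    · obtain ⟨b, c, e1, e2, e3, e4⟩ := quartic_coeffs_of_nonreal_root him hz
      have hb : 0 ≤ b := by nlinarith
      have hdet' := hurwitz_det_mul_quadratic a0 b c (-2 * z.re) (z.re ^ 2 + z.im ^ 2)
      rw [← e1, ← e2, ← e3, ← e4] at hdet'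
      have : 0 ≤ z.re * b * ((c - a0 * (z.re ^ 2 + z.im ^ 2)) ^ 2 + a1 * a3) := by positivity
      linarith

/-- Routh–Hurwitz stability criterion for the damped two-link Ziegler pendulum:
every complex root of the characteristic quartic has strictly negative real part
iff `P < P_cr`, where `P_cr` is the critical flutter load. -/
theorem ziegler_two_link_damped_stability_criterion (l m1 m2 c1 c2 d1 d2 P : ℝ)
    (hl : 0 < l) (hm1 : 0 < m1) (hm2 : 0 < m2) (hc1 : 0 < c1) (hc2 : 0 < c2)
    (hd1 : 0 < d1) (hd2 : 0 < d2) :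
    (∀ lam : ℂ,
        ((l ^ 4 * m1 * m2 : ℝ) : ℂ) * lam ^ 4 +
            ((l ^ 2 * (m1 * d2 + d1 * m2 + 4 * m2 * d2) : ℝ) : ℂ) * lam ^ 3 +
            ((d1 * d2 + m1 * l ^ 2 * c2 + 4 * m2 * l ^ 2 * c2 + c1 * m2 * l ^ 2 -
                2 * P * l ^ 3 * m2 : ℝ) : ℂ) * lam ^ 2 +
            ((d1 * c2 + c1 * d2 : ℝ) : ℂ) * lam + ((c1 * c2 : ℝ) : ℂ) = 0 →
          lam.re < 0) ↔
      P < (4 * m2 ^ 2 * (d2 ^ 2 * c1 ^ 2 + d1 ^ 2 * c2 ^ 2) +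
            d1 * d2 * (8 * m2 * (m1 + 2 * m2) * c2 ^ 2 + (c1 * m2 - m1 * c2) ^ 2)) /
          (2 * m2 * l * (4 * m2 * d2 + d1 * m2 + m1 * d2) * (c1 * d2 + d1 * c2)) +
        (1 / 2) * (d1 * d2) / (m2 * l ^ 3) := by
  rw [routh_hurwitz_quartic (by positivity) (by positivity) (by positivity) (by positivity),
    ← sub_pos (b := P)]
  set A := 4 * m2 * d2 + d1 * m2 + m1 * d2 with hA
  set B := c1 * d2 + d1 * c2 with hB
  have hApos : 0 < A := by positivity
  have hBpos : 0 < B := by positivity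
  have hk : 0 < 2 * m2 * l ^ 5 * A * B := by positivity
  refine Iff.trans (Eq.to_iff (congrArg (0 < ·) ?_)) (mul_pos_iff_of_pos_left hk)
  field_simp
  rw [hA, hB]
  ring
end

section
/- Let f(β) = (4·β² + 33·β + 4) / (2·(β + 6)·(β + 1)) for β ≥ 0 (the zero-damping limit of the critical flutter load of the damped two-link Ziegler pendulum with c1 = c2 = 1, l = 1, m1 = 2, m2 = 1 along the damping ratio d1/d2 = β). Then f(β) ≤ 7/2 − √2 for all β ≥ 0, with equality if and only if β = 4 + 5·√2; in particular, the limit of the damped critical load as the damping coefficients tend to zero along a fixed ratio never exceeds the undamped critical flutter load 7/2 − √2 and coincides with it only for the distinguished damping ratio β = 4 + 5·√2. -/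
/-- The gap between the undamped critical load and the zero-damping limit is a multiple of
a perfect square. -/
theorem ziegler_undamped_sub_zero_damping_limit {β : ℝ} (hβ : 0 ≤ β) :
    7 / 2 - Real.sqrt 2 - (4 * β ^ 2 + 33 * β + 4) / (2 * (β + 6) * (β + 1)) =
      (3 - 2 * Real.sqrt 2) / (2 * (β + 6) * (β + 1)) * (β - (4 + 5 * Real.sqrt 2)) ^ 2 := by
  have hsq : Real.sqrt 2 ^ 2 = 2 := Real.sq_sqrt (by norm_num)
  have h6 : β + 6 ≠ 0 := by positivity
  have h1 : β + 1 ≠ 0 := by positivity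
  field_simp
  linear_combination (5 - 20 * β + 50 * Real.sqrt 2) * hsq

/-- The zero-damping limit `f(β) = (4β² + 33β + 4)/(2(β + 6)(β + 1))` of the critical
flutter load of the damped two-link Ziegler pendulum (with `c1 = c2 = 1`, `l = 1`,
`m1 = 2`, `m2 = 1` and damping ratio `d1/d2 = β`) never exceeds the undamped critical
load `7/2 − √2`, with equality exactly at the distinguished ratio `β = 4 + 5√2`. -/
theorem ziegler_zero_damping_limit_le_undamped (β : ℝ) (hβ : 0 ≤ β) :
    (4 * β ^ 2 + 33 * β + 4) / (2 * (β + 6) * (β + 1)) ≤ 7 / 2 - Real.sqrt 2 ∧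
    ((4 * β ^ 2 + 33 * β + 4) / (2 * (β + 6) * (β + 1)) = 7 / 2 - Real.sqrt 2 ↔
      β = 4 + 5 * Real.sqrt 2) := by
  have gap := ziegler_undamped_sub_zero_damping_limit hβ
  have hsq : Real.sqrt 2 ^ 2 = 2 := Real.sq_sqrt (by norm_num)
  have hnum : 0 < 3 - 2 * Real.sqrt 2 := by nlinarith [Real.sqrt_nonneg 2]
  have hcoef : 0 < (3 - 2 * Real.sqrt 2) / (2 * (β + 6) * (β + 1)) := by positivity
  constructor
  · rw [← sub_nonneg, gap]
    positivity
  · rw [eq_comm, ← sub_eq_zero, gap, mul_eq_zero_iff_left hcoef.ne', sq_eq_zero_iff,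
      sub_eq_zero]
end

section
/- For the damped two-link Ziegler pendulum with c1 = c2 = 1, l = 1, m1 = 2, m2 = 1 and damping ratio d1 = β·d2 with β ≥ 0 fixed, the critical flutter load satisfies lim_{d2→0⁺} P_cr(β·d2, d2) = (4·β² + 33·β + 4) / (2·(β + 6)·(β + 1)); in particular this limit depends on the direction β in the damping plane, so the function P_cr(d1, d2) has no limit as (d1, d2) → (0, 0) (the discontinuity underlying the Whitney-umbrella structure of the stability boundary). -/
open Filter Topology

/-- Along the ray `d1 = β d2`, the critical load differs from its limiting value by the
quadratic term `β d2² / 2`. -/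
theorem ziegler_critical_load_along_ray {β d : ℝ} (hβ : 0 ≤ β) (hd : 0 < d) :
    (4 * (β * d) ^ 2 + 33 * (β * d) * d + 4 * d ^ 2) / (2 * (6 * d + β * d) * (d + β * d)) +
        (1 / 2) * (β * d) * d =
      (4 * β ^ 2 + 33 * β + 4) / (2 * (β + 6) * (β + 1)) + β * d ^ 2 / 2 := by
  have h6 : β + 6 ≠ 0 := by positivity
  have h1 : β + 1 ≠ 0 := by positivity
  have hnum : 4 * (β * d) ^ 2 + 33 * (β * d) * d + 4 * d ^ 2 =
      (4 * β ^ 2 + 33 * β + 4) * d ^ 2 := by ring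
  have hden : 2 * (6 * d + β * d) * (d + β * d) = 2 * (β + 6) * (β + 1) * d ^ 2 := by ring
  rw [hnum, hden, mul_div_mul_right _ _ (pow_ne_zero 2 hd.ne')]
  ring

/-- A ray of positive slope approaches the origin within the open positive quadrant. -/
theorem tendsto_ray_nhdsWithin_quadrant {β : ℝ} (hβ : 0 < β) :
    Tendsto (fun d : ℝ => (β * d, d)) (𝓝[>] 0)
      (𝓝[Set.Ioi 0 ×ˢ Set.Ioi 0] ((0, 0) : ℝ × ℝ)) := by
  refine tendsto_nhdsWithin_iff.2 ⟨?_, ?_⟩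
  · have h : Continuous fun d : ℝ => (β * d, d) := by fun_prop
    simpa using (h.tendsto 0).mono_left nhdsWithin_le_nhds
  · filter_upwards [self_mem_nhdsWithin] with d hd
    exact ⟨mul_pos hβ hd, hd⟩

/-- For the damped two-link Ziegler pendulum with `c1 = c2 = 1`, `l = 1`, `m1 = 2`,
`m2 = 1`, critical flutter load
`P_cr(d1,d2) = (4d1² + 33 d1 d2 + 4d2²)/(2(6d2 + d1)(d2 + d1)) + (1/2) d1 d2`,
and damping ratio `d1 = β d2`: as `d2 → 0⁺` the critical load tends to
`(4β² + 33β + 4)/(2(β + 6)(β + 1))`, a limit depending on the direction `β`; hence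
`P_cr` has no limit as `(d1, d2) → (0, 0)` within the positive quadrant. -/
theorem ziegler_damped_critical_load_direction_dependent_limit
    (Pcr : ℝ → ℝ → ℝ)
    (hPcr : ∀ d1 d2 : ℝ, Pcr d1 d2 =
      (4 * d1 ^ 2 + 33 * d1 * d2 + 4 * d2 ^ 2) / (2 * (6 * d2 + d1) * (d2 + d1)) +
        (1 / 2) * d1 * d2) :
    (∀ β : ℝ, 0 ≤ β →
        Tendsto (fun d2 : ℝ => Pcr (β * d2) d2) (𝓝[>] 0)
          (𝓝 ((4 * β ^ 2 + 33 * β + 4) / (2 * (β + 6) * (β + 1))))) ∧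
    ¬ ∃ L : ℝ,
        Tendsto (fun d : ℝ × ℝ => Pcr d.1 d.2)
          (𝓝[Set.Ioi 0 ×ˢ Set.Ioi 0] (0, 0)) (𝓝 L) := by
  have hray : ∀ β : ℝ, 0 ≤ β →
      Tendsto (fun d2 : ℝ => Pcr (β * d2) d2) (𝓝[>] 0)
        (𝓝 ((4 * β ^ 2 + 33 * β + 4) / (2 * (β + 6) * (β + 1)))) := by
    intro β hβ
    have hcont : Continuous fun d : ℝ =>
        (4 * β ^ 2 + 33 * β + 4) / (2 * (β + 6) * (β + 1)) + β * d ^ 2 / 2 := by fun_prop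
    have hlim := (hcont.tendsto 0).mono_left (nhdsWithin_le_nhds (s := Set.Ioi 0))
    norm_num only [mul_zero, zero_div, add_zero, ne_eq, zero_pow] at hlim
    refine hlim.congr' ?_
    filter_upwards [self_mem_nhdsWithin] with d hd
    rw [hPcr, ziegler_critical_load_along_ray hβ hd]
  refine ⟨hray, ?_⟩
  rintro ⟨L, hL⟩
  have h1 := tendsto_nhds_unique (hL.comp (tendsto_ray_nhdsWithin_quadrant one_pos))
    (hray 1 zero_le_one)
  have h2 := tendsto_nhds_unique (hL.comp (tendsto_ray_nhdsWithin_quadrant two_pos))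
    (hray 2 zero_le_two)
  norm_num [h1] at h2
end
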